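/- arXiv:1910.14344 — 4 statements merged into one kernel-verified Lean document; each statement's English description precedes it below -/
import Mathlib

section
/- Let V be a finite vertex set, let E be a finite multiset of ordered pairs over V (the edge multiset of a directed multigraph), and let P ≤ E be a sub-multiset consisting of the edges of a directed path from x to y (edges (v_0,v_1), (v_1,v_2), …, (v_{ℓ-1},v_ℓ) with v_0 = x, v_ℓ = y). Let E' be obtained from E by removing P and adding the reversal of every edge of P. Then for every S ⊆ V with x ∈ S: if y ∉ S, then both the number of edges of E' from S to V∖S and the total number of edges of E' whose tail lies in S are exactly one less than the corresponding quantities for E; if y ∈ S, then both quantities are unchanged. -/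
/-- Along a walk, the edges leaving `S` outnumber those entering `S` by the difference of the
indicators of `S` at the two ends. -/
theorem card_filter_cut_walk {V : Type*} [DecidableEq V] (S : Finset V) (v : ℕ → V) (ℓ : ℕ) :
    (((Multiset.range ℓ).map (fun i => (v i, v (i + 1)))).filter
        (fun e => e.1 ∈ S ∧ e.2 ∉ S)).card + (if v ℓ ∈ S then 1 else 0) =
      ((((Multiset.range ℓ).map (fun i => (v i, v (i + 1)))).map (fun e => (e.2, e.1))).filter
        (fun e => e.1 ∈ S ∧ e.2 ∉ S)).card + (if v 0 ∈ S then 1 else 0) := by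
  induction ℓ with
  | zero => simp
  | succ n ih =>
    simp only [Multiset.range_succ, Multiset.map_cons, Multiset.filter_cons, Multiset.card_add]
    by_cases h : v n ∈ S <;> by_cases h' : v (n + 1) ∈ S <;> simp [h, h'] at ih ⊢ <;> omega

/-- Along a walk, the tails in `S` outnumber the heads in `S` by the difference of the
indicators of `S` at the two ends. -/
theorem card_filter_tail_walk {V : Type*} [DecidableEq V] (S : Finset V) (v : ℕ → V) (ℓ : ℕ) :
    (((Multiset.range ℓ).map (fun i => (v i, v (i + 1)))).filter
        (fun e => e.1 ∈ S)).card + (if v ℓ ∈ S then 1 else 0) =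
      ((((Multiset.range ℓ).map (fun i => (v i, v (i + 1)))).map (fun e => (e.2, e.1))).filter
        (fun e => e.1 ∈ S)).card + (if v 0 ∈ S then 1 else 0) := by
  induction ℓ with
  | zero => simp
  | succ n ih =>
    simp only [Multiset.range_succ, Multiset.map_cons, Multiset.filter_cons, Multiset.card_add]
    by_cases h : v n ∈ S <;> by_cases h' : v (n + 1) ∈ S <;> simp [h, h'] at ih ⊢ <;> omega


/-- Let `E` be a finite multiset of ordered pairs over a finite vertex set `V`
(the edge multiset of a directed multigraph), and let `P ≤ E` be a
sub-multiset consisting of the edges of a directed path from `x` to `y`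
(edges `(v 0, v 1), (v 1, v 2), …, (v (ℓ-1), v ℓ)` with `v 0 = x`, `v ℓ = y`,
and distinct vertices).  Let `E'` be obtained from `E` by removing `P` and
adding the reversal of every edge of `P`.  Then for every `S ⊆ V` with
`x ∈ S`: if `y ∉ S`, then both the number of edges of `E'` from `S` to
`V ∖ S` and the total number of edges of `E'` whose tail lies in `S` are
exactly one less than the corresponding quantities for `E`; if `y ∈ S`, then
both quantities are unchanged. -/
theorem stmt_1 {V : Type*} [DecidableEq V]
    (E P : Multiset (V × V)) (x y : V) (ℓ : ℕ) (v : ℕ → V)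
    (hPE : P ≤ E)
    (hx : v 0 = x) (hy : v ℓ = y)
    (hinj : ∀ i ≤ ℓ, ∀ j ≤ ℓ, v i = v j → i = j)
    (hP : P = (Multiset.range ℓ).map (fun i => (v i, v (i + 1))))
    (S : Finset V) (hxS : x ∈ S) :
    (y ∉ S →
      (((E - P) + P.map (fun e => (e.2, e.1))).filter
          (fun e => e.1 ∈ S ∧ e.2 ∉ S)).card + 1 =
        (E.filter (fun e => e.1 ∈ S ∧ e.2 ∉ S)).card ∧
      (((E - P) + P.map (fun e => (e.2, e.1))).filter (fun e => e.1 ∈ S)).card + 1 =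
        (E.filter (fun e => e.1 ∈ S)).card) ∧
    (y ∈ S →
      (((E - P) + P.map (fun e => (e.2, e.1))).filter
          (fun e => e.1 ∈ S ∧ e.2 ∉ S)).card =
        (E.filter (fun e => e.1 ∈ S ∧ e.2 ∉ S)).card ∧
      (((E - P) + P.map (fun e => (e.2, e.1))).filter (fun e => e.1 ∈ S)).card =
        (E.filter (fun e => e.1 ∈ S)).card) := by
  have hcut := card_filter_cut_walk S v ℓ
  have htail := card_filter_tail_walk S v ℓ
  rw [← hP, hx, hy, if_pos hxS] at hcut htail
  obtain ⟨F, rfl⟩ := Multiset.le_iff_exists_add.mp hPE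
  simp only [add_tsub_cancel_left, Multiset.filter_add, Multiset.card_add]
  by_cases hyS : y ∈ S <;> simp only [hyS, if_true, if_false] at hcut htail <;>
    simp only [hyS, not_true_eq_false, not_false_eq_true, false_imp_iff, true_imp_iff, true_and,
      and_true] <;> omega
end

section
/- Let G=(V,E) be a finite directed graph in which every vertex has out-degree at least 1, let x ∈ V, and let G'=(V',E') be the split graph of G with respect to x. Let (L,S,R) be a separation triple of G with x ∈ L and S = N^out_G(L), and let L' = {v_in, v_out : v ∈ L} ∪ {v_in : v ∈ S} ⊆ V'. Then the number of edges of G' from L' to V'∖L' equals |S|, and vol^out_G(L) ≤ vol^out_{G'}(L') ≤ 3·vol^out_G(L). -/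
/-- The number of edges of `E` from `X` to its complement. -/
def cutE {V : Type*} [DecidableEq V] (E : Finset (V × V)) (X : Finset V) : ℕ :=
  (E.filter (fun e => e.1 ∈ X ∧ e.2 ∉ X)).card

/-- The out-volume of `X`: the number of edges of `E` whose tail lies in `X`. -/
def volOut {V : Type*} [DecidableEq V] (E : Finset (V × V)) (X : Finset V) : ℕ :=
  (E.filter (fun e => e.1 ∈ X)).card

/-- The out-degree of a vertex `u`. -/
def degOut {V : Type*} [DecidableEq V] (E : Finset (V × V)) (u : V) : ℕ :=
  (E.filter (fun e => e.1 = u)).card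

/-- The set of out-neighbors of `X` lying outside `X`. -/
def noutSet {V : Type*} [DecidableEq V] (E : Finset (V × V)) (X : Finset V) : Finset V :=
  ((E.filter (fun e => e.1 ∈ X)).image Prod.snd) \ X

/-- `(L, S, R)` is a separation triple: `L, S, R` partition `V`, `L` and `R` are
nonempty, and there is no edge from `L` to `R`. -/
def IsSepTriple {V : Type*} [Fintype V] [DecidableEq V]
    (E : Finset (V × V)) (L S R : Finset V) : Prop :=
  L.Nonempty ∧ R.Nonempty ∧ Disjoint L S ∧ Disjoint L R ∧ Disjoint S R ∧
    L ∪ S ∪ R = Finset.univ ∧ ∀ e ∈ E, e.1 ∈ L → e.2 ∉ R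

/-- The vertex set of the split graph w.r.t. `x`: the vertex `x` (with the
convention `x_in = x_out = x`) together with, for each `v ≠ x`, two copies
`v_in` (the left summand) and `v_out` (the right summand). -/
abbrev SplitV (V : Type*) (x : V) := V ⊕ {v : V // v ≠ x}

/-- The in-copy `v_in` of a vertex `v` in the split graph. -/
def inV {V : Type*} (x : V) (v : V) : SplitV V x := Sum.inl v

/-- The out-copy `v_out` of a vertex `v` in the split graph (`x_out = x_in = x`). -/
def outV {V : Type*} [DecidableEq V] (x : V) (v : V) : SplitV V x :=
  if h : v = x then Sum.inl x else Sum.inr ⟨v, h⟩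

/-- The edge set of the split graph w.r.t. `x`: an edge `(u_out, v_in)` for every
edge `(u, v)` of `G`, and an edge `(v_in, v_out)` for every vertex `v ≠ x`. -/
def splitE {V : Type*} [Fintype V] [DecidableEq V] (E : Finset (V × V)) (x : V) :
    Finset (SplitV V x × SplitV V x) :=
  (E.image (fun e => (outV x e.1, inV x e.2))) ∪
    ((Finset.univ.filter (fun v => v ≠ x)).image (fun v => (inV x v, outV x v)))

theorem inV_injective {V : Type*} (x : V) : Function.Injective (inV x) :=
  Sum.inl_injective

theorem outV_injective {V : Type*} [DecidableEq V] (x : V) : Function.Injective (outV x) := by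
  intro u v h
  unfold outV at h
  split_ifs at h <;> simp_all

theorem outV_eq_inV_iff {V : Type*} [DecidableEq V] {x u v : V} :
    outV x u = inV x v ↔ u = x ∧ v = x := by
  unfold outV inV
  split_ifs with h
  · simp [h, eq_comm]
  · simp [h]

theorem inV_mem_iff {V : Type*} [DecidableEq V] {x : V} {L S : Finset V} (hx : x ∈ L) (v : V) :
    inV x v ∈ L.image (inV x) ∪ L.image (outV x) ∪ S.image (inV x) ↔ v ∈ L ∪ S := by
  simp only [Finset.mem_union, Finset.mem_image, (inV_injective x).eq_iff, outV_eq_inV_iff]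
  grind

theorem outV_mem_iff {V : Type*} [DecidableEq V] {x : V} {L S : Finset V} (hx : x ∈ L) (v : V) :
    outV x v ∈ L.image (inV x) ∪ L.image (outV x) ∪ S.image (inV x) ↔ v ∈ L := by
  simp only [Finset.mem_union, Finset.mem_image, (outV_injective x).eq_iff,
    eq_comm (b := outV x v), outV_eq_inV_iff]
  grind

theorem card_noutSet_le_volOut {V : Type*} [DecidableEq V] (E : Finset (V × V)) (X : Finset V) :
    (noutSet E X).card ≤ volOut E X :=
  (Finset.card_le_card Finset.sdiff_subset).trans Finset.card_image_le

theorem card_le_volOut {V : Type*} [DecidableEq V] {E : Finset (V × V)}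
    (hdeg : ∀ u : V, 1 ≤ degOut E u) (X : Finset V) : X.card ≤ volOut E X := by
  have hsub : X ⊆ (E.filter (fun e => e.1 ∈ X)).image Prod.fst := by
    intro u hu
    obtain ⟨e, he⟩ := Finset.card_pos.mp (hdeg u)
    rw [Finset.mem_filter] at he
    exact Finset.mem_image.mpr ⟨e, Finset.mem_filter.mpr ⟨he.1, he.2 ▸ hu⟩, he.2⟩
  exact (Finset.card_le_card hsub).trans Finset.card_image_le

/-- Let `G = (V, E)` be a finite directed graph in which every vertex has
out-degree at least `1`, let `x ∈ V`, and let `G'` be the split graph of `G`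
with respect to `x`.  Let `(L, S, R)` be a separation triple of `G` with
`x ∈ L` and `S = N^out_G(L)`, and let
`L' = {v_in, v_out : v ∈ L} ∪ {v_in : v ∈ S}`.  Then the number of edges of
`G'` from `L'` to its complement equals `|S|`, and
`vol^out_G(L) ≤ vol^out_{G'}(L') ≤ 3 · vol^out_G(L)`. -/
theorem stmt_2 {V : Type*} [Fintype V] [DecidableEq V]
    (E : Finset (V × V)) (hdeg : ∀ u : V, 1 ≤ degOut E u)
    (x : V) (L S R : Finset V)
    (hsep : IsSepTriple E L S R) (hxL : x ∈ L) (hS : S = noutSet E L) :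
    cutE (splitE E x) (L.image (inV x) ∪ L.image (outV x) ∪ S.image (inV x)) = S.card ∧
    volOut E L ≤
      volOut (splitE E x) (L.image (inV x) ∪ L.image (outV x) ∪ S.image (inV x)) ∧
    volOut (splitE E x) (L.image (inV x) ∪ L.image (outV x) ∪ S.image (inV x)) ≤
      3 * volOut E L := by
  have hin := inV_mem_iff (S := S) hxL
  have hout := outV_mem_iff (S := S) hxL
  have hdisj : Disjoint L S := hsep.2.2.1
  generalize L.image (inV x) ∪ L.image (outV x) ∪ S.image (inV x) = L' at hin hout ⊢
  have hheads : ∀ e ∈ E, e.1 ∈ L → e.2 ∈ L ∪ S := by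
    intro e he heL
    simp only [hS, noutSet, Finset.mem_union, Finset.mem_sdiff, Finset.mem_image,
      Finset.mem_filter]
    by_cases h : e.2 ∈ L
    · exact Or.inl h
    · exact Or.inr ⟨⟨e, ⟨he, heL⟩, rfl⟩, h⟩
  have hne : ∀ v ∈ S, v ≠ x := fun v hv h => Finset.disjoint_left.mp hdisj hxL (h ▸ hv)
  have hcut : (splitE E x).filter (fun e => e.1 ∈ L' ∧ e.2 ∉ L') =
      S.image (fun v => (inV x v, outV x v)) := by
    ext e
    simp only [splitE, Finset.mem_filter, Finset.mem_union, Finset.mem_image,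
      Finset.mem_univ, true_and]
    constructor
    · rintro ⟨⟨f, hf, rfl⟩ | ⟨v, hv, rfl⟩, h₁, h₂⟩
      · exact absurd ((hin _).mpr (hheads f hf ((hout _).mp h₁))) h₂
      · rw [hin, Finset.mem_union] at h₁
        rw [hout] at h₂
        exact ⟨v, h₁.resolve_left h₂, rfl⟩
    · rintro ⟨v, hv, rfl⟩
      exact ⟨Or.inr ⟨v, hne v hv, rfl⟩, (hin v).mpr (Finset.mem_union_right _ hv),
        fun h => Finset.disjoint_left.mp hdisj ((hout v).mp h) hv⟩
  have hvol : (splitE E x).filter (fun e => e.1 ∈ L') =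
      (E.filter (fun e => e.1 ∈ L)).image (fun e => (outV x e.1, inV x e.2)) ∪
        ((L ∪ S).filter (fun v => v ≠ x)).image (fun v => (inV x v, outV x v)) := by
    simp only [splitE, Finset.filter_union, Finset.filter_image, hin, hout]
    congr 2
    ext v
    simp [and_or_left, and_comm]
  have hinj : Function.Injective (fun e : V × V => (outV x e.1, inV x e.2)) :=
    (outV_injective x).prodMap (inV_injective x)
  refine ⟨?_, ?_, ?_⟩
  · rw [cutE, hcut, Finset.card_image_of_injective]
    exact fun u v h => inV_injective x (Prod.ext_iff.mp h).1
  · rw [volOut, volOut, hvol, ← Finset.card_image_of_injective _ hinj]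
    exact Finset.card_le_card Finset.subset_union_left
  · have hL := card_le_volOut hdeg L
    have hSle : S.card ≤ volOut E L := hS ▸ card_noutSet_le_volOut E L
    calc volOut (splitE E x) L'
        ≤ volOut E L + (L ∪ S).card := by
          rw [volOut, hvol]
          exact (Finset.card_union_le _ _).trans (add_le_add Finset.card_image_le
            (Finset.card_image_le.trans (Finset.card_filter_le _ _)))
      _ ≤ volOut E L + (L.card + S.card) := Nat.add_le_add_left (Finset.card_union_le _ _) _
      _ ≤ 3 * volOut E L := by lia
end

section
/- Let G=(V,E) be a finite directed graph with n vertices and m edges, let k ≥ 1 be an integer and ε > 0 a real number, and let F be a finite family of pairwise disjoint vertex subsets such that Σ_{X∈F} (k − d^out(X)) > εm. For each i ∈ {0, 1, …, ⌊log₂ k⌋}, let C_i = {X ∈ F : 2^i ≤ k − d^out(X) < 2^{i+1}} and C_{i,small} = {X ∈ C_i : vol^out(X) < 2^{i+2} ε^{−1} (⌊log₂ k⌋ + 1)}. Then there exists i* ∈ {0, 1, …, ⌊log₂ k⌋} such that |C_{i*,small}| > εm / (2^{i*+2}(⌊log₂ k⌋ + 1)) ≥ εm / (4k(⌊log₂ k⌋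 + 1)). In particular, if additionally m ≥ nk/4, then |C_{i*,small}| > εn / (16(⌊log₂ k⌋ + 1)). -/
/-- The out-volumes of pairwise disjoint vertex sets add up to at most the number of edges. -/
theorem sum_volOut_le_card {V : Type*} [DecidableEq V] (E : Finset (V × V))
    (F : Finset (Finset V)) (hdisj : ∀ X ∈ F, ∀ Y ∈ F, X ≠ Y → Disjoint X Y) :
    ∑ X ∈ F, volOut E X ≤ E.card := by
  unfold volOut
  rw [← Finset.card_biUnion]
  · exact Finset.card_le_card (Finset.biUnion_subset.2 fun X _ => Finset.filter_subset _ _)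
  · intro X hX Y hY hXY
    refine Finset.disjoint_filter.2 fun e _ h₁ h₂ => ?_
    exact Finset.disjoint_left.1 (hdisj X hX Y hY hXY) h₁ h₂

/-- A sum of integers bounded by `k` is at most the sum of its dyadic pieces. -/
theorem sum_le_sum_dyadic {ι : Type*} (F : Finset ι) (a : ι → ℤ) (k : ℕ)
    (ha : ∀ x ∈ F, a x ≤ k) :
    ∑ x ∈ F, a x ≤ ∑ i ∈ Finset.range (Nat.log 2 k + 1),
      ∑ x ∈ F with (2 : ℤ) ^ i ≤ a x ∧ a x < 2 ^ (i + 1), a x := by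
  simp only [Finset.sum_filter]
  rw [Finset.sum_comm]
  refine Finset.sum_le_sum fun x hx => ?_
  have hnonneg : ∀ i ∈ Finset.range (Nat.log 2 k + 1),
      0 ≤ if (2 : ℤ) ^ i ≤ a x ∧ a x < 2 ^ (i + 1) then a x else 0 := by
    intro i _
    split_ifs with h
    · exact le_trans (by positivity) h.1
    · exact le_rfl
  rcases le_or_gt (a x) 0 with h0 | h0
  · exact h0.trans (Finset.sum_nonneg hnonneg)
  · obtain ⟨b, hb⟩ := Int.eq_ofNat_of_zero_le h0.le
    have hbk : b ≤ k := by have := ha x hx; omega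
    have hb0 : b ≠ 0 := by omega
    have hlog : Nat.log 2 b ∈ Finset.range (Nat.log 2 k + 1) :=
      Finset.mem_range.2 (Nat.lt_succ_of_le (Nat.log_mono_right hbk))
    refine le_trans ?_ (Finset.single_le_sum hnonneg hlog)
    rw [if_pos]
    rw [hb]
    exact ⟨mod_cast Nat.pow_log_le_self 2 hb0, mod_cast Nat.lt_pow_succ_log_self one_lt_two b⟩

/-- Some dyadic class carries more than the average share of a lower bound on the sum. -/
theorem exists_lt_card_dyadic {ι : Type*} (F : Finset ι) (a : ι → ℤ) (k : ℕ)
    (ha : ∀ x ∈ F, a x ≤ k) (c : ℝ) (hc : c < ∑ x ∈ F, (a x : ℝ)) :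
    ∃ i ≤ Nat.log 2 k, c < ((Nat.log 2 k : ℝ) + 1) *
      (2 ^ (i + 1) * ((F.filter fun x => (2 : ℤ) ^ i ≤ a x ∧ a x < 2 ^ (i + 1)).card : ℝ)) := by
  have hle : ∑ x ∈ F, (a x : ℝ) ≤ ∑ i ∈ Finset.range (Nat.log 2 k + 1),
      ∑ x ∈ F with (2 : ℤ) ^ i ≤ a x ∧ a x < 2 ^ (i + 1), (a x : ℝ) := by
    exact_mod_cast sum_le_sum_dyadic F a k ha
  by_contra! hcon
  have hL : (0 : ℝ) < (Nat.log 2 k : ℝ) + 1 := by positivity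
  have hpiece : ∀ i ∈ Finset.range (Nat.log 2 k + 1),
      ∑ x ∈ F with (2 : ℤ) ^ i ≤ a x ∧ a x < 2 ^ (i + 1), (a x : ℝ) ≤
        c / ((Nat.log 2 k : ℝ) + 1) := by
    intro i hi
    rw [le_div_iff₀' hL]
    refine le_trans (mul_le_mul_of_nonneg_left ?_ hL.le)
      (hcon i (Nat.lt_succ_iff.1 (Finset.mem_range.1 hi)))
    rw [mul_comm, ← nsmul_eq_mul]
    refine Finset.sum_le_card_nsmul _ _ _ fun x hx => ?_
    exact_mod_cast (Finset.mem_filter.1 hx).2.2.le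
  have htotal := hle.trans (Finset.sum_le_card_nsmul _ _ _ hpiece)
  rw [Finset.card_range, nsmul_eq_mul, Nat.cast_succ, mul_div_cancel₀ _ hL.ne'] at htotal
  exact absurd hc htotal.not_gt

/-- Few members of a family of disjoint vertex sets have out-volume at least `t`. -/
theorem mul_card_le_card_of_le_volOut {V : Type*} [DecidableEq V] (E : Finset (V × V))
    (F S : Finset (Finset V)) (hSF : S ⊆ F)
    (hdisj : ∀ X ∈ F, ∀ Y ∈ F, X ≠ Y → Disjoint X Y) (t : ℝ)
    (ht : ∀ X ∈ S, t ≤ volOut E X) : t * S.card ≤ E.card := by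
  have hsum : (∑ X ∈ S, (volOut E X : ℝ)) ≤ E.card := by
    exact_mod_cast sum_volOut_le_card E S fun X hX Y hY => hdisj X (hSF hX) Y (hSF hY)
  rw [mul_comm, ← nsmul_eq_mul]
  exact (Finset.card_nsmul_le_sum S _ t ht).trans hsum

/- **Statement 7.**
Let `G = (V, E)` be a finite directed graph with `n` vertices and `m` edges,
let `k ≥ 1` be an integer and `ε > 0` a real number, and let `F` be a finite
family of pairwise disjoint vertex subsets with
`Σ_{X ∈ F} (k − d^out(X)) > εm`.  For each `i ∈ {0, …, ⌊log₂ k⌋}` let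
`C_i = {X ∈ F : 2^i ≤ k − d^out(X) < 2^(i+1)}` and
`C_{i,small} = {X ∈ C_i : vol^out(X) < 2^(i+2) ε⁻¹ (⌊log₂ k⌋ + 1)}`.  Then
there exists `i* ∈ {0, …, ⌊log₂ k⌋}` such that
`|C_{i*,small}| > εm / (2^(i*+2)(⌊log₂ k⌋ + 1)) ≥ εm / (4k(⌊log₂ k⌋ + 1))`.
In particular, if additionally `m ≥ nk/4`, then
`|C_{i*,small}| > εn / (16(⌊log₂ k⌋ + 1))`. -/
open Classical in
theorem stmt_7 {V : Type*} [Fintype V] [DecidableEq V]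
    (E : Finset (V × V)) (k : ℕ) (hk : 1 ≤ k) (ε : ℝ) (hε : 0 < ε)
    (F : Finset (Finset V))
    (hdisj : ∀ X ∈ F, ∀ Y ∈ F, X ≠ Y → Disjoint X Y)
    (hsum : ε * E.card < ∑ X ∈ F, ((k : ℝ) - (cutE E X : ℝ))) :
    ∃ i ≤ Nat.log 2 k,
      (ε * E.card / ((2 : ℝ) ^ (i + 2) * ((Nat.log 2 k : ℝ) + 1)) <
        ((F.filter (fun X =>
            ((2 : ℤ) ^ i ≤ (k : ℤ) - (cutE E X : ℤ) ∧
              (k : ℤ) - (cutE E X : ℤ) < 2 ^ (i + 1)) ∧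
            (volOut E X : ℝ) <
              (2 : ℝ) ^ (i + 2) * ε⁻¹ * ((Nat.log 2 k : ℝ) + 1))).card : ℝ)) ∧
      (ε * E.card / (4 * (k : ℝ) * ((Nat.log 2 k : ℝ) + 1)) ≤
        ε * E.card / ((2 : ℝ) ^ (i + 2) * ((Nat.log 2 k : ℝ) + 1))) ∧
      ((Fintype.card V : ℝ) * k / 4 ≤ (E.card : ℝ) →
        ε * (Fintype.card V : ℝ) / (16 * ((Nat.log 2 k : ℝ) + 1)) <
          ((F.filter (fun X =>
              ((2 : ℤ) ^ i ≤ (k : ℤ) - (cutE E X : ℤ) ∧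
                (k : ℤ) - (cutE E X : ℤ) < 2 ^ (i + 1)) ∧
              (volOut E X : ℝ) <
                (2 : ℝ) ^ (i + 2) * ε⁻¹ * ((Nat.log 2 k : ℝ) + 1))).card : ℝ)) := by
  have hL : (0 : ℝ) < (Nat.log 2 k : ℝ) + 1 := by positivity
  have hk0 : (0 : ℝ) < k := by exact_mod_cast hk
  obtain ⟨i, hi, hcard⟩ := exists_lt_card_dyadic F (fun X => (k : ℤ) - (cutE E X : ℤ)) k
    (fun X _ => by omega) (ε * E.card) (by push_cast; exact hsum)
  have hpow : (2 : ℝ) ^ i ≤ k := by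
    exact_mod_cast (Nat.pow_le_pow_right two_pos hi).trans (Nat.pow_log_le_self 2 (by omega))
  set C := F.filter fun X => (2 : ℤ) ^ i ≤ (k : ℤ) - (cutE E X : ℤ) ∧
    (k : ℤ) - (cutE E X : ℤ) < 2 ^ (i + 1) with hC
  have hlarge := mul_card_le_card_of_le_volOut E F
    (C.filter fun X => ¬ (volOut E X : ℝ) < (2 : ℝ) ^ (i + 2) * ε⁻¹ * ((Nat.log 2 k : ℝ) + 1))
    ((Finset.filter_subset _ _).trans (Finset.filter_subset _ _)) hdisj _
    (fun X hX => not_lt.1 (Finset.mem_filter.1 hX).2)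
  have hsplit := Finset.card_filter_add_card_filter_not (s := C)
    (fun X => (volOut E X : ℝ) < (2 : ℝ) ^ (i + 2) * ε⁻¹ * ((Nat.log 2 k : ℝ) + 1))
  rw [← @Nat.cast_inj ℝ, Nat.cast_add] at hsplit
  have hsmall : ε * E.card / ((2 : ℝ) ^ (i + 2) * ((Nat.log 2 k : ℝ) + 1)) <
      ((C.filter fun X => (volOut E X : ℝ) <
        (2 : ℝ) ^ (i + 2) * ε⁻¹ * ((Nat.log 2 k : ℝ) + 1)).card : ℝ) := by
    rw [div_lt_iff₀ (by positivity)]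
    have hlarge' := mul_le_mul_of_nonneg_left hlarge hε.le
    rw [← mul_assoc, show ε * ((2 : ℝ) ^ (i + 2) * ε⁻¹ * ((Nat.log 2 k : ℝ) + 1)) =
      2 ^ (i + 2) * ((Nat.log 2 k : ℝ) + 1) by field_simp] at hlarge'
    rw [← hsplit] at hcard
    have hstep : (2 : ℝ) ^ (i + 2) = 2 ^ (i + 1) * 2 := pow_succ 2 (i + 1)
    generalize ((C.filter fun X => (volOut E X : ℝ) <
      (2 : ℝ) ^ (i + 2) * ε⁻¹ * ((Nat.log 2 k : ℝ) + 1)).card : ℝ) = s at hcard ⊢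
    generalize ((C.filter fun X => ¬ (volOut E X : ℝ) <
      (2 : ℝ) ^ (i + 2) * ε⁻¹ * ((Nat.log 2 k : ℝ) + 1)).card : ℝ) = l at hcard hlarge'
    rw [hstep] at hlarge' ⊢
    linarith
  have hclass : ε * E.card / (4 * (k : ℝ) * ((Nat.log 2 k : ℝ) + 1)) ≤
      ε * E.card / ((2 : ℝ) ^ (i + 2) * ((Nat.log 2 k : ℝ) + 1)) := by
    refine div_le_div_of_nonneg_left (by positivity) (by positivity)
      (mul_le_mul_of_nonneg_right ?_ hL.le)
    rw [pow_add]
    linarith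
  rw [hC, Finset.filter_filter] at hsmall
  refine ⟨i, hi, by convert hsmall, hclass, fun hm => lt_of_le_of_lt ?_
    (lt_of_le_of_lt hclass (by convert hsmall))⟩
  rw [div_le_div_iff₀ (by positivity) (by positivity)]
  have := mul_le_mul_of_nonneg_left hm (show 0 ≤ 16 * ε * ((Nat.log 2 k : ℝ) + 1) by positivity)
  linarith
end

section
/- Let G=(V,E) be a finite simple directed graph with n vertices and m edges, let k ≥ 1 be an integer and ε a real number with ε > 4/k, and let F be a finite family of pairwise disjoint vertex subsets such that Σ_{X∈F} max(k − d^out(X), 0) > εm. Then more than εm/(2k) vertices of G have out-degree less than k. In particular, if additionally m ≥ nk/4, then more than εn/8 vertices of G have out-degree less than k. -/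
/-- Filters by membership in pairwise disjoint sets have total size at most the ambient set. -/
theorem sum_card_filter_mem_le {V α : Type*} [DecidableEq V] [DecidableEq α]
    (F : Finset (Finset V)) (hdisj : ∀ X ∈ F, ∀ Y ∈ F, X ≠ Y → Disjoint X Y)
    (S : Finset α) (f : α → V) :
    ∑ X ∈ F, (S.filter (fun a => f a ∈ X)).card ≤ S.card := by
  rw [← Finset.card_biUnion]
  · exact Finset.card_le_card (Finset.biUnion_subset.2 fun X _ => Finset.filter_subset _ _)
  · intro X hX Y hY hXY
    refine Finset.disjoint_filter.2 fun a _ haX haY => ?_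
    exact Finset.disjoint_left.1 (hdisj X hX Y hY hXY) haX haY

/-- The number of edges leaving vertices of `X` is the sum of their out-degrees. -/
theorem card_filter_fst_mem_eq_sum_degOut {V : Type*} [DecidableEq V]
    (E : Finset (V × V)) (X : Finset V) :
    (E.filter (fun e => e.1 ∈ X)).card = ∑ u ∈ X, degOut E u := by
  rw [Finset.card_eq_sum_card_fiberwise (s := E.filter (fun e => e.1 ∈ X)) (f := Prod.fst)
    (t := X) (fun e he => (Finset.mem_filter.1 he).2)]
  refine Finset.sum_congr rfl fun u hu => ?_
  rw [degOut, Finset.filter_filter]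
  congr 1
  refine Finset.filter_congr fun e _ => ?_
  constructor
  · exact And.right
  · rintro rfl
    exact ⟨hu, rfl⟩

/-- An edge starting in `X` either crosses the cut or lies in `X ×ˢ X`. -/
theorem card_filter_fst_mem_le_cutE_add {V : Type*} [DecidableEq V]
    (E : Finset (V × V)) (X : Finset V) :
    (E.filter (fun e => e.1 ∈ X)).card ≤ cutE E X + X.card * X.card := by
  rw [cutE, ← Finset.card_product]
  refine (Finset.card_le_card fun e he => ?_).trans (Finset.card_union_le _ _)
  simp only [Finset.mem_union, Finset.mem_filter, Finset.mem_product] at he ⊢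
  tauto

/-- If all out-degrees in a nonempty set `X` are at least `k`, the deficiency of `X` is at most
twice the size of `X`. -/
theorem le_cutE_add_two_mul_card {V : Type*} [DecidableEq V]
    (E : Finset (V × V)) (k : ℕ) (X : Finset V) (hX : X.Nonempty)
    (hdeg : ∀ u ∈ X, k ≤ degOut E u) : k ≤ cutE E X + 2 * X.card := by
  have hvol : X.card * k ≤ cutE E X + X.card * X.card := by
    refine le_trans ?_ (card_filter_fst_mem_le_cutE_add E X)
    rw [card_filter_fst_mem_eq_sum_degOut]
    simpa using Finset.card_nsmul_le_sum X (degOut E) k hdeg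
  have hpos := hX.card_pos
  by_contra! h
  obtain ⟨s, hs⟩ : ∃ s, X.card = s + 1 := ⟨X.card - 1, by lia⟩
  rw [hs] at hvol h
  nlinarith [Nat.zero_le s, mul_le_mul_of_nonneg_left h.le (Nat.zero_le s)]

/-- The deficiency of a nonempty set is controlled by its low-degree vertices and its volume. -/
theorem deficiency_le {V : Type*} [Fintype V] [DecidableEq V]
    (E : Finset (V × V)) (k : ℕ) (hk : 1 ≤ k) (X : Finset V) (hX : X.Nonempty) :
    max ((k : ℝ) - (cutE E X : ℝ)) 0 ≤
      k * (((Finset.univ.filter (fun u : V => degOut E u < k)).filter (fun u => u ∈ X)).card : ℝ) +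
        2 / k * ((E.filter (fun e => e.1 ∈ X)).card : ℝ) := by
  have hk0 : (0 : ℝ) < k := by exact_mod_cast hk
  refine max_le ?_ (by positivity)
  by_cases hdeg : ∀ u ∈ X, k ≤ degOut E u
  · have hcut : (k : ℝ) ≤ cutE E X + 2 * X.card := by
      exact_mod_cast le_cutE_add_two_mul_card E k X hX hdeg
    have hvol : (X.card : ℝ) * k ≤ ((E.filter (fun e => e.1 ∈ X)).card : ℝ) := by
      rw [card_filter_fst_mem_eq_sum_degOut]
      exact_mod_cast Finset.card_nsmul_le_sum X (degOut E) k hdeg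
    calc (k : ℝ) - cutE E X ≤ 2 / k * (X.card * k) := by
          field_simp
          linarith
      _ ≤ 2 / k * ((E.filter (fun e => e.1 ∈ X)).card : ℝ) := by gcongr
      _ ≤ _ := le_add_of_nonneg_left (by positivity)
  · push Not at hdeg
    obtain ⟨u, huX, hu⟩ := hdeg
    have hlow : (1 : ℝ) ≤
        (((Finset.univ.filter (fun u : V => degOut E u < k)).filter (fun u => u ∈ X)).card : ℝ) := by
      exact_mod_cast Finset.card_pos.2 ⟨u, by simp [huX, hu]⟩
    calc (k : ℝ) - cutE E X ≤ k * 1 := by simp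
      _ ≤ _ := mul_le_mul_of_nonneg_left hlow hk0.le
      _ ≤ _ := le_add_of_nonneg_right (by positivity)

/-- Let `G = (V, E)` be a finite simple directed graph with `n` vertices and `m`
edges, let `k ≥ 1` be an integer and `ε` a real number with `ε > 4/k`, and let
`F` be a finite family of pairwise disjoint (nonempty) vertex subsets such
that `Σ_{X ∈ F} max(k − d^out(X), 0) > εm`.  Then more than `εm/(2k)` vertices
of `G` have out-degree less than `k`.  In particular, if additionally
`m ≥ nk/4`, then more than `εn/8` vertices of `G` have out-degree less
than `k`. -/
theorem stmt_10 {V : Type*} [Fintype V] [DecidableEq V]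
    (E : Finset (V × V)) (k : ℕ) (hk : 1 ≤ k) (ε : ℝ) (hε : 4 / (k : ℝ) < ε)
    (F : Finset (Finset V))
    (hne : ∀ X ∈ F, X.Nonempty)
    (hdisj : ∀ X ∈ F, ∀ Y ∈ F, X ≠ Y → Disjoint X Y)
    (hsum : ε * E.card < ∑ X ∈ F, max ((k : ℝ) - (cutE E X : ℝ)) 0) :
    (ε * E.card / (2 * (k : ℝ)) <
      ((Finset.univ.filter (fun u : V => degOut E u < k)).card : ℝ)) ∧
    ((Fintype.card V : ℝ) * k / 4 ≤ (E.card : ℝ) →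
      ε * (Fintype.card V : ℝ) / 8 <
        ((Finset.univ.filter (fun u : V => degOut E u < k)).card : ℝ)) := by
  have hk0 : (0 : ℝ) < k := by exact_mod_cast hk
  have hε0 : 0 < ε := lt_trans (by positivity) hε
  have hmain : ε * E.card / (2 * (k : ℝ)) <
      ((Finset.univ.filter (fun u : V => degOut E u < k)).card : ℝ) := by
    set L := Finset.univ.filter (fun u : V => degOut E u < k)
    have hlow : ∑ X ∈ F, ((L.filter (fun u => u ∈ X)).card : ℝ) ≤ L.card := by
      exact_mod_cast sum_card_filter_mem_le F hdisj L id
    have hvol : ∑ X ∈ F, ((E.filter (fun e => e.1 ∈ X)).card : ℝ) ≤ E.card := by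
      exact_mod_cast sum_card_filter_mem_le F hdisj E Prod.fst
    have hbound : ε * E.card < k * L.card + 2 / k * E.card := by
      refine hsum.trans_le ((Finset.sum_le_sum fun X hX =>
        deficiency_le E k hk X (hne X hX)).trans ?_)
      rw [Finset.sum_add_distrib, ← Finset.mul_sum, ← Finset.mul_sum]
      gcongr
    have hhalf : 2 / k * (E.card : ℝ) ≤ ε / 2 * E.card := by
      refine mul_le_mul_of_nonneg_right ?_ (Nat.cast_nonneg _)
      have : (4 : ℝ) / k = 2 * (2 / k) := by ring
      linarith
    rw [div_lt_iff₀ (by positivity)]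
    linarith
  refine ⟨hmain, fun hm => lt_of_le_of_lt ?_ hmain⟩
  rw [le_div_iff₀ (by positivity)]
  calc ε * (Fintype.card V : ℝ) / 8 * (2 * k) = ε * ((Fintype.card V : ℝ) * k / 4) := by ring
    _ ≤ ε * E.card := by gcongr
end
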